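/- A loop (L,·) is both a left B-loop (with self map σ) and a right B-loop (with self map σ) if and only if it is a σ-M-loop, i.e., satisfies (xy)·(zσ(x)) = (x·yz)σ(x). -/

import Mathlib

/-- A loop: a quasigroup with two-sided identity. -/
class MyLoop (L : Type*) extends Mul L, One L where
  one_mul : ∀ a : L, 1 * a = a
  mul_one : ∀ a : L, a * 1 = a
  ldiv : L → L → L
  rdiv : L → L → L
  mul_ldiv : ∀ a b : L, a * ldiv a b = b
  ldiv_mul : ∀ a b : L, ldiv a (a * b) = b
  rdiv_mul : ∀ a b : L, rdiv a b * b = a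
  mul_rdiv : ∀ a b : L, rdiv (a * b) b = a

namespace MyLoop

variable {L : Type*} [MyLoop L]

/-- right inverse: `x * rho x = 1` -/
def rho (x : L) : L := ldiv x 1

/-- left inverse: `lam x * x = 1` -/
def lam (x : L) : L := rdiv 1 x

/-- right translation `R_a : y ↦ y * a`, as a bijection -/
def Rt (a : L) : Equiv.Perm L :=
  ⟨fun y => y * a, fun y => rdiv y a, fun y => mul_rdiv y a, fun y => rdiv_mul y a⟩

/-- left translation `L_a : y ↦ a * y`, as a bijection -/
def Lt (a : L) : Equiv.Perm L :=
  ⟨fun y => a * y, fun y => ldiv a y, fun y => ldiv_mul a y, fun y => mul_ldiv a y⟩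

/-- σ-generalized (right) Bol loop identity -/
def GBol (σ : L → L) : Prop := ∀ x y z : L, ((x * y) * z) * σ y = x * ((y * z) * σ y)

/-- σ-generalized left Bol loop identity -/
def LBol (σ : L → L) : Prop := ∀ x y z : L, σ y * (z * (y * x)) = (σ y * (z * y)) * x

/-- σ-M-loop identity -/
def MLoopP (σ : L → L) : Prop := ∀ x y z : L, (x * y) * (z * σ x) = (x * (y * z)) * σ x

/-- right inverse property -/
def RIP (L : Type*) [MyLoop L] : Prop := ∀ x y : L, (y * x) * rho x = y

/-- left inverse property -/
def LIP (L : Type*) [MyLoop L] : Prop := ∀ x y : L, lam x * (x * y) = y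

/-- right nucleus -/
def Nrho (L : Type*) [MyLoop L] : Set L := {a | ∀ y z : L, (z * y) * a = z * (y * a)}

/-- middle nucleus -/
def Nmu (L : Type*) [MyLoop L] : Set L := {a | ∀ y z : L, (z * a) * y = z * (a * y)}

/-- multiplication of the A-holomorph `H = A × L`, `(α,x)∘(β,y) = (αβ, xβ · y)` -/
def hmul (A : Subgroup (MulAut L)) (p q : ↥A × L) : ↥A × L :=
  (p.1 * q.1, (q.1 : MulAut L) p.2 * q.2)

/-- the right inverse of an element of the holomorph -/
def hrho (A : Subgroup (MulAut L)) (p : ↥A × L) : ↥A × L :=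
  (p.1⁻¹, rho ((p.1⁻¹ : MulAut L) p.2))

/-- the holomorph is a σ'-generalized Bol loop, where `σ'(α,x) = (α, σ x)` -/
def HGBol (A : Subgroup (MulAut L)) (σ : L → L) : Prop :=
  ∀ p q r : ↥A × L,
    hmul A (hmul A (hmul A p q) r) (q.1, σ q.2) =
      hmul A p (hmul A (hmul A q r) (q.1, σ q.2))

end MyLoop

open MyLoop

namespace MyLoop

theorem mul_left_cancel_loop {L : Type*} [MyLoop L] {a b c : L} (h : a * b = a * c) : b = c := by
  rw [← ldiv_mul a b, h, ldiv_mul]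

theorem mul_right_cancel_loop {L : Type*} [MyLoop L] {a b c : L} (h : b * a = c * a) : b = c := by
  rw [← mul_rdiv b a, h, mul_rdiv]

theorem mul_rho {L : Type*} [MyLoop L] (x : L) : x * rho x = 1 := mul_ldiv x 1

theorem lam_mul {L : Type*} [MyLoop L] (x : L) : lam x * x = 1 := rdiv_mul 1 x

/-- The inverse property, with `rho` as the two-sided inverse. -/
structure HasIP (L : Type*) [MyLoop L] : Prop where
  rho_mul_cancel : ∀ x y : L, rho x * (x * y) = y
  mul_rho_cancel : ∀ x y : L, (y * x) * rho x = y

namespace HasIP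

variable {L : Type*} [MyLoop L]

theorem rho_mul (h : HasIP L) (x : L) : rho x * x = 1 := by
  simpa only [MyLoop.mul_one] using h.rho_mul_cancel x 1

theorem rho_rho (h : HasIP L) (x : L) : rho (rho x) = x :=
  mul_left_cancel_loop (a := rho x) ((mul_rho _).trans (h.rho_mul x).symm)

theorem mul_rho_mul (h : HasIP L) (x y : L) : x * (rho x * y) = y := by
  simpa only [h.rho_rho] using h.rho_mul_cancel (rho x) y

theorem mul_mul_rho (h : HasIP L) (x y : L) : (y * rho x) * x = y := by
  simpa only [h.rho_rho] using h.mul_rho_cancel (rho x) y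

theorem rho_mul_rev (h : HasIP L) (x y : L) : rho (x * y) = rho y * rho x := by
  have e : y * rho (x * y) = rho x := by
    have := h.mul_rho_cancel (x * y) (rho x)
    rwa [h.rho_mul_cancel] at this
  rw [← e, h.rho_mul_cancel]

/-- In an inverse property loop, the M-identity at `x, s` gives the right Bol identity there. -/
theorem right_bol_of_mloop (h : HasIP L) {x s : L}
    (hM : ∀ y z : L, (x * y) * (z * s) = (x * (y * z)) * s) (u v : L) :
    ((u * x) * v) * s = u * ((x * v) * s) := by
  have e := hM (rho (u * x)) ((u * x) * v)
  rw [h.rho_mul_cancel, h.rho_mul_rev, h.mul_rho_mul] at e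
  rw [← e, h.mul_rho_mul]

/-- In an inverse property loop, the right Bol identity at `x, s` gives the M-identity there. -/
theorem mloop_of_right_bol (h : HasIP L) {x s : L}
    (hB : ∀ u v : L, ((u * x) * v) * s = u * ((x * v) * s)) (y z : L) :
    (x * y) * (z * s) = (x * (y * z)) * s := by
  have e := hB (rho (x * y)) (y * z)
  rw [h.rho_mul_rev, h.mul_mul_rho, h.rho_mul_cancel, ← h.rho_mul_rev] at e
  rw [e, h.mul_rho_mul]

/-- The M-identity at `x, s` passes to the inverses of `x` and `s`. -/
theorem mloop_rho (h : HasIP L) {x s : L}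
    (hM : ∀ y z : L, (x * y) * (z * s) = (x * (y * z)) * s) (y z : L) :
    (rho x * y) * (z * rho s) = (rho x * (y * z)) * rho s := by
  have e := hM (rho x * y) (z * rho s)
  have c := hM 1 ((rho x * y) * (z * rho s))
  rw [MyLoop.mul_one, MyLoop.one_mul] at c
  rw [h.mul_rho_mul, h.mul_mul_rho, ← c] at e
  rw [e, h.rho_mul_cancel, h.mul_rho_cancel]

/-- In an inverse property loop, the M-identity at `x, s` gives the left Bol identity there. -/
theorem left_bol_of_mloop (h : HasIP L) {x s : L}
    (hM : ∀ y z : L, (x * y) * (z * s) = (x * (y * z)) * s) (u v : L) :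
    s * (v * (x * u)) = (s * (v * x)) * u := by
  have e := congrArg rho (h.right_bol_of_mloop (h.mloop_rho hM) (rho u) (rho v))
  simpa only [h.rho_mul_rev, h.rho_rho] using e

end HasIP

variable {L : Type*} [MyLoop L] {σ : L → L}

theorem LBol.lip (h : LBol σ) : LIP L := fun y x => by
  have e := h x y (lam y)
  rw [lam_mul, MyLoop.mul_one] at e
  exact mul_left_cancel_loop e

theorem GBol.rip (h : GBol σ) : RIP L := fun y x => by
  have e := h x y (rho y)
  rw [mul_rho, MyLoop.one_mul] at e
  exact mul_right_cancel_loop e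

theorem hasIP_of_lip_rip (hl : LIP L) (hr : RIP L) : HasIP L where
  rho_mul_cancel x y := by
    have e := hl x (rho x)
    rw [mul_rho, MyLoop.mul_one] at e
    rw [← e, hl]
  mul_rho_cancel x y := hr x y

theorem MLoopP.hasIP (h : MLoopP σ) : HasIP L := by
  have mul_rho_mul (x z : L) : x * (rho x * z) = z := by
    have e := h x (rho x) z
    rw [mul_rho, MyLoop.one_mul] at e
    exact (mul_right_cancel_loop e).symm
  have rho_rho (x : L) : rho (rho x) = x := by
    have e := mul_rho_mul x (rho (rho x))
    rwa [mul_rho, MyLoop.mul_one, eq_comm] at e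
  have rho_mul_cancel (x z : L) : rho x * (x * z) = z := by
    simpa only [rho_rho] using mul_rho_mul (rho x) z
  have rho_mul_rev (x u : L) : rho (x * rho u) = u * rho x := by
    have e := h x (rho u) (u * rho x)
    rw [rho_mul_cancel, mul_rho, MyLoop.one_mul] at e
    refine mul_right_cancel_loop (a := σ x) (mul_left_cancel_loop (a := x * rho u) ?_)
    rw [e, mul_rho_mul]
  refine ⟨rho_mul_cancel, fun x y => ?_⟩
  rw [← rho_rho (y * x), ← rho_mul_rev]
  have e := rho_mul_rev (rho x) y
  rw [rho_rho] at e
  rw [← e, rho_rho, rho_rho, mul_rho_mul, rho_rho]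

end MyLoop

/-- a loop is both a left B-loop and a right B-loop (w.r.t. σ)
iff it is a σ-M-loop. -/
theorem lbol_and_gbol_iff_mloop {L : Type*} [MyLoop L] (σ : L → L) :
    (LBol σ ∧ GBol σ) ↔ MLoopP σ := by
  constructor
  · rintro ⟨hL, hG⟩ x y z
    exact (hasIP_of_lip_rip hL.lip hG.rip).mloop_of_right_bol (fun u v => hG u x v) y z
  · intro hM
    exact ⟨fun x y z => hM.hasIP.left_bol_of_mloop (hM y) x z,
      fun x y z => hM.hasIP.right_bol_of_mloop (hM y) x z⟩
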